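/- arXiv:1210.2657 — 2 statements merged into one kernel-verified Lean document; each statement's English description precedes it below -/
import Mathlib

section
/- For each integer d ≥ 3 let α*(d) denote the unique solution in ((d−1)/(d−2), ∞) of α·log((d−2)·α/(d−1)) − α + 1/(d−2) = 0. Then α*(d) → e as d → ∞. -/
/-- For each integer `d ≥ 3`, let `α*(d)` be the unique solution in
`((d−1)/(d−2), ∞)` of `α·log((d−2)·α/(d−1)) − α + 1/(d−2) = 0`. Then `α*(d) → e` as `d → ∞`. -/
theorem stmt3 (αstar : ℕ → ℝ)
    (hαstar : ∀ d : ℕ, 3 ≤ d →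
      αstar d ∈ Set.Ioi (((d : ℝ) - 1) / ((d : ℝ) - 2)) ∧
      αstar d * Real.log (((d : ℝ) - 2) * αstar d / ((d : ℝ) - 1)) - αstar d
        + 1 / ((d : ℝ) - 2) = 0) :
    Filter.Tendsto αstar Filter.atTop (nhds (Real.exp 1)) := by
  have he : Filter.Tendsto (fun d : ℕ => 1 / ((d : ℝ) - 2)) Filter.atTop (nhds 0) := by
    have h1 : Filter.Tendsto (fun d : ℕ => (d : ℝ) - 2) Filter.atTop Filter.atTop :=
      Filter.tendsto_atTop_add_const_right _ (-2) tendsto_natCast_atTop_atTop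
    simpa [Pi.inv_def] using h1.inv_tendsto_atTop
  have hlo : Filter.Tendsto
      (fun d : ℕ => (1 + 1 / ((d : ℝ) - 2)) * Real.exp (1 - 1 / ((d : ℝ) - 2)))
      Filter.atTop (nhds (Real.exp 1)) := by
    have hc : Continuous (fun x : ℝ => (1 + x) * Real.exp (1 - x)) := by fun_prop
    have := (hc.tendsto 0).comp he
    simpa [Function.comp_def] using this
  have hhi : Filter.Tendsto
      (fun d : ℕ => (1 + 1 / ((d : ℝ) - 2)) * Real.exp 1)
      Filter.atTop (nhds (Real.exp 1)) := by
    have hc : Continuous (fun x : ℝ => (1 + x) * Real.exp 1) := by fun_prop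
    have := (hc.tendsto 0).comp he
    simpa [Function.comp_def] using this
  have key : ∀ d : ℕ, 3 ≤ d → 0 < 1 / ((d : ℝ) - 2) ∧ 1 < αstar d ∧
      αstar d = (1 + 1 / ((d : ℝ) - 2)) * Real.exp (1 - 1 / ((d : ℝ) - 2) / αstar d) := by
    intro d hd
    obtain ⟨h1, h2⟩ := hαstar d hd
    have h1 : ((d : ℝ) - 1) / ((d : ℝ) - 2) < αstar d := h1
    have hd' : (3 : ℝ) ≤ d := by exact_mod_cast hd
    have hp : (0 : ℝ) < (d : ℝ) - 2 := by linarith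
    have hq : (0 : ℝ) < (d : ℝ) - 1 := by linarith
    have h3 : 1 < ((d : ℝ) - 1) / ((d : ℝ) - 2) := by
      rw [lt_div_iff₀ hp]; linarith
    have h4 : 1 < αstar d := h3.trans h1
    have h5 : 0 < αstar d := by linarith
    refine ⟨by positivity, h4, ?_⟩
    have h6 : Real.log (((d : ℝ) - 2) * αstar d / ((d : ℝ) - 1))
        = 1 - 1 / ((d : ℝ) - 2) / αstar d := by
      rw [eq_sub_iff_add_eq, ← mul_right_inj' h5.ne', mul_add, mul_div_cancel₀ _ h5.ne']
      linarith
    rw [← h6, Real.exp_log (by positivity)]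
    field_simp
    ring
  refine tendsto_of_tendsto_of_tendsto_of_le_of_le' hlo hhi ?_ ?_
  all_goals
    filter_upwards [Filter.eventually_ge_atTop 3] with d hd
    obtain ⟨h1, h2, h3⟩ := key d hd
  · have : 1 / ((d : ℝ) - 2) / αstar d ≤ 1 / ((d : ℝ) - 2) := div_le_self h1.le h2.le
    calc _ ≤ (1 + 1 / ((d : ℝ) - 2)) * Real.exp (1 - 1 / ((d : ℝ) - 2) / αstar d) := by
          gcongr
      _ = αstar d := h3.symm
  · have : 0 ≤ 1 / ((d : ℝ) - 2) / αstar d := by positivity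
    calc αstar d = _ := h3
      _ ≤ _ := by
        gcongr
        linarith
end

section
/- Fix an integer d ≥ 3 and, for n ≥ 2, set r = ⌊(log n)³⌋ and q = ⌊2√(d·n·log n)⌋. Then for all sufficiently large n and every integer k with r ≤ k ≤ 2q, P( Bin(dk, (k+2)/n) ≥ k/√r ) ≤ exp( −k/(3√r) ) < n^{−5}. -/
/-- `P(Bin(m,p) ≥ x)`: the upper tail of a binomial distribution with `m` trials and success
probability `p`. -/
noncomputable def binomTail (m : ℕ) (p : ℝ) (x : ℝ) : ℝ :=
  ∑ k ∈ Finset.range (m + 1),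
    if x ≤ (k : ℝ) then (m.choose k : ℝ) * p ^ k * (1 - p) ^ (m - k) else 0

theorem binomTail_le (m : ℕ) (p x : ℝ) (hp : 0 ≤ p) (hp1 : p ≤ 1) :
    binomTail m p x ≤ Real.exp (-x + 2 * (p * m)) := by
  have h1 : binomTail m p x ≤ Real.exp (-x) * (p * Real.exp 1 + (1 - p)) ^ m := by
    rw [add_pow, Finset.mul_sum]
    unfold binomTail
    apply Finset.sum_le_sum
    intro k _
    have hq : 0 ≤ 1 - p := by linarith
    have hnn : 0 ≤ (m.choose k : ℝ) * p ^ k * (1 - p) ^ (m - k) := by positivity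
    have e1 : Real.exp (-x) * ((p * Real.exp 1) ^ k * (1 - p) ^ (m - k) * (m.choose k : ℝ))
        = ((m.choose k : ℝ) * p ^ k * (1 - p) ^ (m - k)) * Real.exp ((k : ℝ) - x) := by
      rw [mul_pow, ← Real.exp_nat_mul, sub_eq_add_neg (k : ℝ) x, Real.exp_add, mul_one]
      ring
    rw [e1]
    split_ifs with h
    · have : 1 ≤ Real.exp ((k : ℝ) - x) := Real.one_le_exp (by linarith)
      exact le_mul_of_one_le_right hnn this
    · positivity
  refine h1.trans ?_
  rw [Real.exp_add]
  refine mul_le_mul_of_nonneg_left ?_ (Real.exp_pos _).le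
  have h2 : p * Real.exp 1 + (1 - p) ≤ Real.exp (2 * p) := by
    have := Real.add_one_le_exp (2 * p)
    have h3 := Real.exp_one_lt_d9
    have h4 : p * Real.exp 1 ≤ p * 3 := mul_le_mul_of_nonneg_left (by linarith) hp
    linarith
  have h0 : 0 ≤ p * Real.exp 1 + (1 - p) := by
    have := mul_nonneg hp (Real.exp_pos 1).le
    linarith
  calc _ ≤ Real.exp (2 * p) ^ m := pow_le_pow_left₀ h0 h2 m
    _ = _ := by rw [← Real.exp_nat_mul]; ring_nf

/-- Fix `d ≥ 3`; for `n ≥ 2` set `r = ⌊(log n)³⌋` and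
`q = ⌊2√(d·n·log n)⌋`. Then, for all large `n` and every `k` with `r ≤ k ≤ 2q`,
`P(Bin(dk, (k+2)/n) ≥ k/√r) ≤ exp(−k/(3√r)) < n^{−5}`. -/
theorem stmt14 (d : ℕ) (hd : 3 ≤ d) :
    ∀ᶠ n : ℕ in Filter.atTop, ∀ k : ℕ,
      ⌊Real.log n ^ 3⌋₊ ≤ k → k ≤ 2 * ⌊2 * Real.sqrt ((d : ℝ) * n * Real.log n)⌋₊ →
      binomTail (d * k) (((k : ℝ) + 2) / (n : ℝ))
          ((k : ℝ) / Real.sqrt (⌊Real.log n ^ 3⌋₊ : ℝ))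
        ≤ Real.exp (-((k : ℝ) / (3 * Real.sqrt (⌊Real.log n ^ 3⌋₊ : ℝ)))) ∧
      Real.exp (-((k : ℝ) / (3 * Real.sqrt (⌊Real.log n ^ 3⌋₊ : ℝ)))) < (n : ℝ) ^ (-5 : ℤ) := by
  have hdR : (3 : ℝ) ≤ d := by exact_mod_cast hd
  have E1 : ∀ᶠ n : ℕ in Filter.atTop, 226 ≤ Real.log n :=
    (Real.tendsto_log_atTop.comp tendsto_natCast_atTop_atTop).eventually_ge_atTop 226
  have E2 : ∀ᶠ n : ℕ in Filter.atTop, 324 * (d : ℝ) ^ 3 * Real.log n ^ 4 ≤ n := by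
    have h := (Real.isLittleO_pow_log_id_atTop (n := 4)).def
      (show (0 : ℝ) < 1 / (324 * (d : ℝ) ^ 3) by positivity)
    have h' := tendsto_natCast_atTop_atTop (R := ℝ) |>.eventually h
    filter_upwards [h'] with n hn
    simp only [id, Real.norm_eq_abs, Nat.abs_cast] at hn
    have h5 := (le_abs_self _).trans hn
    rw [one_div, inv_mul_eq_div, le_div_iff₀ (by positivity)] at h5
    linarith
  filter_upwards [E1, E2, Filter.eventually_ge_atTop 1] with n hL hn hn1 k hrk hkq
  have hnpos : (0 : ℝ) < n := by exact_mod_cast hn1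
  set L := Real.log n with hLdef
  set r := ⌊L ^ 3⌋₊ with hr
  have hr1 : (r : ℝ) ≤ L ^ 3 := Nat.floor_le (by positivity)
  have hr2 : L ^ 3 < r + 1 := Nat.lt_floor_add_one _
  have hrL : 225 * L ^ 2 < r := by nlinarith [mul_le_mul_of_nonneg_right hL (sq_nonneg L)]
  have hrk' : (r : ℝ) ≤ k := by exact_mod_cast hrk
  set s := Real.sqrt (r : ℝ) with hs
  have hs2 : s ^ 2 = r := Real.sq_sqrt (by positivity)
  have hs0 : 0 ≤ s := Real.sqrt_nonneg _
  have hsL : 15 * L < s := by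
    apply lt_of_pow_lt_pow_left₀ 2 hs0
    rw [hs2]; linarith
  have hspos : 0 < s := by linarith
  set w := Real.sqrt ((d : ℝ) * n * L) with hw
  have hw2 : w ^ 2 = d * n * L := Real.sq_sqrt (by positivity)
  have hw0 : 0 ≤ w := Real.sqrt_nonneg _
  have hkw : (k : ℝ) ≤ 4 * w := by
    have h1 : (k : ℝ) ≤ 2 * (⌊2 * w⌋₊ : ℝ) := by exact_mod_cast hkq
    have h2 : (⌊2 * w⌋₊ : ℝ) ≤ 2 * w := Nat.floor_le (by positivity)
    linarith
  have hk4 : (4 : ℝ) ≤ k := by nlinarith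
  have hk2 : (k : ℝ) + 2 ≤ 6 * w := by linarith
  have hmain : 3 * d * (k + 2) * s ≤ n := by
    have h1 : 18 * d * (w * s) ≤ n := by
      refine (pow_le_pow_iff_left₀ (by positivity) hnpos.le two_ne_zero).mp ?_
      have e : (18 * d * (w * s)) ^ 2 = 324 * d ^ 2 * (w ^ 2 * s ^ 2) := by ring
      rw [e, hw2, hs2]
      calc 324 * (d : ℝ) ^ 2 * (d * n * L * r) ≤ 324 * (d : ℝ) ^ 2 * (d * n * L * L ^ 3) := by
            gcongr
        _ = (324 * (d : ℝ) ^ 3 * L ^ 4) * n := by ring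
        _ ≤ n * n := by gcongr
        _ = _ := by ring
    calc 3 * d * ((k : ℝ) + 2) * s ≤ 3 * d * (6 * w) * s := by gcongr
      _ = 18 * d * (w * s) := by ring
      _ ≤ n := h1
  constructor
  · refine (binomTail_le _ _ _ (by positivity) ?_).trans ?_
    · rw [div_le_one hnpos]
      have : (1 : ℝ) ≤ 3 * d * s := by nlinarith
      nlinarith
    · apply Real.exp_le_exp.mpr
      have h3 : 2 * (((k : ℝ) + 2) / n * ((d * k : ℕ) : ℝ)) ≤ 2 * (k / (3 * s)) := by
        refine mul_le_mul_of_nonneg_left ?_ (by norm_num)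
        push_cast
        rw [div_mul_eq_mul_div, div_le_div_iff₀ hnpos (by positivity)]
        nlinarith
      have h4 : (k : ℝ) / s = 3 * (k / (3 * s)) := by field_simp
      rw [h4]
      linarith
  · have h5 : (n : ℝ) ^ (-5 : ℤ) = Real.exp (-(5 * L)) := by
      rw [Real.exp_neg, zpow_neg]
      congr 1
      have : (5 : ℝ) * L = (5 : ℕ) * L := by norm_num
      rw [this, Real.exp_nat_mul, hLdef, Real.exp_log hnpos]
      norm_cast
    rw [h5]
    apply Real.exp_lt_exp.mpr
    apply neg_lt_neg
    rw [lt_div_iff₀ (by positivity)]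
    nlinarith
end
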